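/- arXiv:2504.12586 — 6 statements merged into one kernel-verified Lean document; each statement's English description precedes it below -/
import Mathlib

section
/- Let V1 and V2 be finite nonempty types, P1 a column-stochastic matrix from V1 to V2, P2 a column-stochastic matrix from V2 to V1, and π1, π2 probability vectors on V1 and V2 with all entries positive, satisfying the classical detailed balance condition (P1)_{vu} (π1)_u = (P2)_{uv} (π2)_v for all u, v. Let G be the simple graph on the disjoint union V1 ⊕ V2 in which u ∈ V1 and v ∈ V2 are adjacent if and only if (P1)_{vu} > 0 (and there are no edges inside V1 or inside V2). If G is connected, then 𝒫 := P2 · P1 is ergodic in the sense that there exists k₀ such that for all k ≥ k₀ and all u, u' ∈ V1, the entry ((𝒫)^k)_{u'u} is positive. -/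
/-- A positive path through `j` makes the corresponding entry of a product of nonnegative
matrices positive. -/
theorem Matrix.mul_apply_pos_of_nonneg {l m n : Type*} [Fintype m]
    {M : Matrix l m ℝ} {N : Matrix m n ℝ} (hM : ∀ i j, 0 ≤ M i j) (hN : ∀ j k, 0 ≤ N j k)
    {i : l} {j : m} {k : n} (hij : 0 < M i j) (hjk : 0 < N j k) : 0 < (M * N) i k := by
  rw [Matrix.mul_apply]
  exact Finset.sum_pos' (fun a _ => mul_nonneg (hM i a) (hN a k))
    ⟨j, Finset.mem_univ j, mul_pos hij hjk⟩

theorem Matrix.mul_apply_nonneg_of_nonneg {l m n : Type*} [Fintype m]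
    {M : Matrix l m ℝ} {N : Matrix m n ℝ} (hM : ∀ i j, 0 ≤ M i j) (hN : ∀ j k, 0 ≤ N j k)
    (i : l) (k : n) : 0 ≤ (M * N) i k := by
  rw [Matrix.mul_apply]
  exact Finset.sum_nonneg fun a _ => mul_nonneg (hM i a) (hN a k)

theorem Matrix.pow_apply_nonneg_of_nonneg {n : Type*} [Fintype n] [DecidableEq n]
    {A : Matrix n n ℝ} (hA : ∀ i j, 0 ≤ A i j) (k : ℕ) (i j : n) : 0 ≤ (A ^ k) i j := by
  induction k generalizing i j with
  | zero =>
    rw [pow_zero, Matrix.one_apply]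
    split_ifs <;> norm_num
  | succ k ih =>
    rw [pow_succ]
    exact Matrix.mul_apply_nonneg_of_nonneg ih hA i j

/-- For a nonnegative matrix with positive diagonal, positivity of an entry persists in all
higher powers. -/
theorem Matrix.pow_apply_pos_of_le {n : Type*} [Fintype n] [DecidableEq n]
    {A : Matrix n n ℝ} (hA : ∀ i j, 0 ≤ A i j) (hdiag : ∀ i, 0 < A i i) {k m : ℕ}
    (hkm : k ≤ m) {i j : n} (h : 0 < (A ^ k) i j) : 0 < (A ^ m) i j := by
  induction m, hkm using Nat.le_induction with
  | base => exact h
  | succ m _ ih =>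
    rw [pow_succ]
    exact Matrix.mul_apply_pos_of_nonneg (Matrix.pow_apply_nonneg_of_nonneg hA m) hA ih (hdiag j)

/-- A nonnegative matrix with positive diagonal which is irreducible is primitive. -/
theorem Matrix.exists_forall_pow_apply_pos {n : Type*} [Fintype n] [DecidableEq n]
    {A : Matrix n n ℝ} (hA : ∀ i j, 0 ≤ A i j) (hdiag : ∀ i, 0 < A i i)
    (hirr : ∀ i j, ∃ k : ℕ, 0 < (A ^ k) i j) :
    ∃ k₀ : ℕ, ∀ k ≥ k₀, ∀ i j, 0 < (A ^ k) i j := by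
  choose f hf using hirr
  refine ⟨Finset.univ.sup fun p : n × n => f p.1 p.2, fun k hk i j => ?_⟩
  exact Matrix.pow_apply_pos_of_le hA hdiag
    ((Finset.le_sup (f := fun p : n × n => f p.1 p.2) (Finset.mem_univ (i, j))).trans hk) (hf i j)

/-- Under classical detailed balance with strictly positive probability
vectors, if the bipartite support graph of `P1` on `V1 ⊕ V2` (joining `u ∈ V1` to `v ∈ V2`
iff `(P1)_{vu} > 0`) is connected, then `𝒫 := P2 · P1` is ergodic: there exists `k₀` such
that for all `k ≥ k₀`, every entry of `𝒫 ^ k` is positive. -/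
theorem stmt_4 {V1 V2 : Type*} [Fintype V1] [Fintype V2] [DecidableEq V1] [Nonempty V1] [Nonempty V2]
    (P1 : Matrix V2 V1 ℝ) (P2 : Matrix V1 V2 ℝ) (π1 : V1 → ℝ) (π2 : V2 → ℝ)
    (hP1nonneg : ∀ v u, 0 ≤ P1 v u)
    (hP1col : ∀ u, ∑ v, P1 v u = 1)
    (hP2nonneg : ∀ u v, 0 ≤ P2 u v)
    (hP2col : ∀ v, ∑ u, P2 u v = 1)
    (hπ1pos : ∀ u, 0 < π1 u) (hπ1sum : ∑ u, π1 u = 1)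
    (hπ2pos : ∀ v, 0 < π2 v) (hπ2sum : ∑ v, π2 v = 1)
    (hCDB : ∀ u v, P1 v u * π1 u = P2 u v * π2 v)
    (G : SimpleGraph (V1 ⊕ V2))
    (hG : G = SimpleGraph.fromRel
      (fun x y => ∃ u v, x = Sum.inl u ∧ y = Sum.inr v ∧ 0 < P1 v u))
    (hconn : G.Connected) :
    ∃ k₀ : ℕ, ∀ k ≥ k₀, ∀ u u' : V1, 0 < ((P2 * P1) ^ k) u' u := by
  have hP2pos : ∀ {u v}, 0 < P1 v u → 0 < P2 u v := fun {u v} h =>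
    pos_of_mul_pos_left (hCDB u v ▸ mul_pos h (hπ1pos u)) (hπ2pos v).le
  have hA : ∀ i j, 0 ≤ (P2 * P1) i j := Matrix.mul_apply_nonneg_of_nonneg hP2nonneg hP1nonneg
  have hstep : ∀ {u u' v}, 0 < P1 v u → 0 < P1 v u' → 0 < (P2 * P1) u' u := fun h h' =>
    Matrix.mul_apply_pos_of_nonneg hP2nonneg hP1nonneg (hP2pos h') h
  have hdiag : ∀ i, 0 < (P2 * P1) i i := by
    intro i
    obtain ⟨v, -, hv⟩ := Finset.exists_lt_of_sum_lt
      (s := Finset.univ) (f := fun _ : V2 => (0 : ℝ)) (g := fun v => P1 v i) (by simp [hP1col])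
    exact hstep hv hv
  have hirr : ∀ u' u, ∃ k : ℕ, 0 < ((P2 * P1) ^ k) u' u := by
    intro u' u
    let reached : V1 ⊕ V2 → Prop := Sum.elim
      (fun w => ∃ k : ℕ, 0 < ((P2 * P1) ^ k) w u)
      (fun v => ∃ w, 0 < P1 v w ∧ ∃ k : ℕ, 0 < ((P2 * P1) ^ k) w u)
    have hreach : ∀ x, Relation.ReflTransGen G.Adj (Sum.inl u) x → reached x := by
      intro x hx
      induction hx with
      | refl => exact ⟨0, by simp⟩
      | tail _ hadj ih =>
        rw [hG, SimpleGraph.fromRel_adj] at hadj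
        obtain ⟨-, ⟨w, v, rfl, rfl, h⟩ | ⟨w, v, rfl, rfl, h⟩⟩ := hadj
        · exact ⟨w, h, ih⟩
        · obtain ⟨w', h', k, hk⟩ := ih
          refine ⟨k + 1, ?_⟩
          rw [pow_succ']
          exact Matrix.mul_apply_pos_of_nonneg hA (Matrix.pow_apply_nonneg_of_nonneg hA k)
            (hstep h' h) hk
    exact hreach (Sum.inl u')
      ((SimpleGraph.reachable_iff_reflTransGen _ _).1 (hconn.preconnected _ _))
  obtain ⟨k₀, hk₀⟩ := Matrix.exists_forall_pow_apply_pos hA hdiag hirr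
  exact ⟨k₀, fun k hk u u' => hk₀ k hk u' u⟩
end

section
/- Let V1 and V2 be finite nonempty types, P1 a column-stochastic matrix from V1 to V2, P2 a column-stochastic matrix from V2 to V1, and π1, π2 probability vectors on V1 and V2 with all entries positive, satisfying the classical detailed balance condition (P1)_{vu} (π1)_u = (P2)_{uv} (π2)_v for all u, v. Assume the simple graph on V1 ⊕ V2 joining u ∈ V1 to v ∈ V2 exactly when (P1)_{vu} > 0 is connected. Then π1 is the unique stationary probability distribution of 𝒫 := P2 · P1: for any probability vector s on V1 with (P2 · P1) · s = s, one has s = π1. -/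
/-- A nonnegative bipartite weight `w` for which `f` and `g` are mutually harmonic forces `f` and
`g` to agree across every edge of positive weight. -/
theorem eq_of_bipartite_harmonic {α β : Type*} [Fintype α] [Fintype β]
    {w : α → β → ℝ} {f : α → ℝ} {g : β → ℝ} (hw : ∀ a b, 0 ≤ w a b)
    (hf : ∀ a, ∑ b, w a b * (f a - g b) = 0) (hg : ∀ b, ∑ a, w a b * (f a - g b) = 0)
    {a : α} {b : β} (hab : 0 < w a b) : f a = g b := by
  have henergy : ∑ a, ∑ b, w a b * (f a - g b) ^ 2 = 0 := by
    calc ∑ a, ∑ b, w a b * (f a - g b) ^ 2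
        = ∑ a, f a * ∑ b, w a b * (f a - g b) - ∑ b, g b * ∑ a, w a b * (f a - g b) := by
          simp only [Finset.mul_sum]
          rw [Finset.sum_comm (s := (Finset.univ : Finset β))]
          simp only [← Finset.sum_sub_distrib]
          exact Finset.sum_congr rfl fun a _ => Finset.sum_congr rfl fun b _ => by ring
      _ = 0 := by simp [hf, hg]
  have hterm : ∀ a b, 0 ≤ w a b * (f a - g b) ^ 2 := fun a b =>
    mul_nonneg (hw a b) (sq_nonneg _)
  have hrow := (Finset.sum_eq_zero_iff_of_nonneg fun a _ =>
    Finset.sum_nonneg fun b _ => hterm a b).1 henergy a (Finset.mem_univ a)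
  have hzero := (Finset.sum_eq_zero_iff_of_nonneg fun b _ => hterm a b).1 hrow b
    (Finset.mem_univ b)
  exact sub_eq_zero.1 (pow_eq_zero_iff two_ne_zero |>.1
    ((mul_eq_zero.1 hzero).resolve_left hab.ne'))

/-- A function that agrees on adjacent vertices of a connected graph is constant. -/
theorem SimpleGraph.Connected.eq_of_forall_adj {V α : Type*} {G : SimpleGraph V}
    (hG : G.Connected) {h : V → α} (hadj : ∀ x y, G.Adj x y → h x = h y) (x y : V) :
    h x = h y := by
  obtain ⟨p⟩ := hG.preconnected x y
  induction p with
  | nil => rfl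
  | cons hxy _ ih => exact (hadj _ _ hxy).trans ih


/-- Under classical detailed balance with strictly positive probability
vectors and column-stochastic `P1`, `P2`, if the bipartite support graph of `P1` on
`V1 ⊕ V2` is connected, then `π1` is the unique stationary probability distribution of
`𝒫 := P2 · P1`. -/
theorem stmt_5 {V1 V2 : Type*} [Fintype V1] [Fintype V2] [Nonempty V1] [Nonempty V2]
    (P1 : Matrix V2 V1 ℝ) (P2 : Matrix V1 V2 ℝ) (π1 : V1 → ℝ) (π2 : V2 → ℝ)
    (hP1nonneg : ∀ v u, 0 ≤ P1 v u)
    (hP1col : ∀ u, ∑ v, P1 v u = 1)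
    (hP2nonneg : ∀ u v, 0 ≤ P2 u v)
    (hP2col : ∀ v, ∑ u, P2 u v = 1)
    (hπ1pos : ∀ u, 0 < π1 u) (hπ1sum : ∑ u, π1 u = 1)
    (hπ2pos : ∀ v, 0 < π2 v) (hπ2sum : ∑ v, π2 v = 1)
    (hCDB : ∀ u v, P1 v u * π1 u = P2 u v * π2 v)
    (hconn : (SimpleGraph.fromRel
      (fun x y => ∃ u v, x = Sum.inl u ∧ y = Sum.inr v ∧ 0 < P1 v u)).Connected) :
    ∀ s : V1 → ℝ, (∀ u, 0 ≤ s u) → ∑ u, s u = 1 →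
      (P2 * P1).mulVec s = s → s = π1 := by
  intro s _ hssum hs
  have hπ1 : ∀ u, π1 u ≠ 0 := fun u => (hπ1pos u).ne'
  have hπ2 : ∀ v, π2 v ≠ 0 := fun v => (hπ2pos v).ne'
  let f : V1 → ℝ := fun u => s u / π1 u
  let g : V2 → ℝ := fun v => P1.mulVec s v / π2 v
  have hfs : ∀ u, π1 u * f u = s u := fun u => mul_div_cancel₀ (s u) (hπ1 u)
  have hgs : ∀ v, π2 v * g v = P1.mulVec s v := fun v => mul_div_cancel₀ _ (hπ2 v)
  have hedge : ∀ u v, 0 < P1 v u → f u = g v := by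
    intro u v huv
    refine eq_of_bipartite_harmonic (w := fun u v => P1 v u * π1 u)
      (fun u v => mul_nonneg (hP1nonneg v u) (hπ1pos u).le) (fun u => ?_) (fun v => ?_)
      (mul_pos huv (hπ1pos u))
    · calc ∑ v, P1 v u * π1 u * (f u - g v)
          = ∑ v, (P1 v u * s u - P2 u v * P1.mulVec s v) :=
            Finset.sum_congr rfl fun v _ => by
              rw [mul_sub, mul_assoc, hfs, hCDB, mul_assoc, hgs]
        _ = s u - (P2 * P1).mulVec s u := by
            rw [Finset.sum_sub_distrib, ← Finset.sum_mul, hP1col, one_mul,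
              ← Matrix.mulVec_mulVec]
            rfl
        _ = 0 := by rw [hs, sub_self]
    · calc ∑ u, P1 v u * π1 u * (f u - g v)
          = ∑ u, (P1 v u * s u - P2 u v * P1.mulVec s v) :=
            Finset.sum_congr rfl fun u _ => by
              rw [mul_sub, mul_assoc, hfs, hCDB, mul_assoc, hgs]
        _ = 0 := by
            rw [Finset.sum_sub_distrib, ← Finset.sum_mul, hP2col, one_mul]
            exact sub_self _
  have hconst : ∀ u u', f u = f u' := fun u u' =>
    hconn.eq_of_forall_adj (h := Sum.elim f g) (by
      rintro x y ⟨-, ⟨u, v, rfl, rfl, huv⟩ | ⟨u, v, rfl, rfl, huv⟩⟩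
      · exact hedge u v huv
      · exact (hedge u v huv).symm) (Sum.inl u) (Sum.inl u')
  funext u
  have hfu : f u = 1 := by
    rw [← hssum, ← one_mul (f u), ← hπ1sum, Finset.sum_mul]
    exact Finset.sum_congr rfl fun u' _ => by rw [hconst u u', hfs]
  rw [← hfs, hfu, mul_one]
end

section
/- Let V1, V2 and E be finite types, let a, b : V1 → V2 → E → ℂ and π1 : V1 → ℂ, π2 : V2 → ℂ satisfy the quantum detailed balance condition a u v e * π1 u = b u v e * π2 v for all u, v, e, and assume every entry of π1 and of π2 is nonzero. Define (P1)_{vu} := Σ_e |a u v e|², (P2)_{uv} := Σ_e |b u v e|², (D2)_{uv} := Σ_e conj(a u v e) * (b u v e) and (D1)_{vu} := Σ_e conj(b u v e) * (a u v e). Then the product D2 · D1 is similar to P2 · P1 via the diagonal matrix of conjugated entries of π1: for all u, w ∈ V1, (D2 · D1)_{uw} = (conj(π1 w) / conj(π1 u)) * ((P2 · P1)_{uw}), where (P2 · P1)_{uw} is viewed as a complex number. -/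
/-- If `x e * s = y e * t` for all `e`, then the overlap of `x` and `y` is the squared norm of `y`
rescaled by `conj t / conj s`. -/
theorem sum_conj_mul_eq_div_mul_sum_norm_sq {E : Type*} [Fintype E] {x y : E → ℂ} {s t : ℂ}
    (hs : s ≠ 0) (h : ∀ e, x e * s = y e * t) :
    ∑ e, (starRingEnd ℂ) (x e) * y e =
      (starRingEnd ℂ) t / (starRingEnd ℂ) s * ((∑ e, ‖y e‖ ^ 2 : ℝ) : ℂ) := by
  have hs' : (starRingEnd ℂ) s ≠ 0 := (map_ne_zero _).2 hs
  push_cast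
  rw [Finset.mul_sum]
  refine Finset.sum_congr rfl fun e _ => ?_
  have he := congrArg (starRingEnd ℂ) (h e)
  rw [map_mul, map_mul] at he
  rw [← Complex.conj_mul', div_mul_eq_mul_div, eq_div_iff hs']
  linear_combination y e * he


/-- Under the quantum detailed balance condition with all entries of `π1`
and `π2` nonzero, the product of discriminant matrices `D2 · D1` is similar to `P2 · P1`
via the diagonal matrix of conjugated entries of `π1`:
`(D2 · D1)_{uw} = (conj(π1 w) / conj(π1 u)) * (P2 · P1)_{uw}`. -/
theorem stmt_9 {V1 V2 E : Type*} [Fintype V1] [Fintype V2] [Fintype E]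
    (a b : V1 → V2 → E → ℂ) (π1 : V1 → ℂ) (π2 : V2 → ℂ)
    (hQDB : ∀ u v e, a u v e * π1 u = b u v e * π2 v)
    (hπ1 : ∀ u, π1 u ≠ 0) (hπ2 : ∀ v, π2 v ≠ 0)
    (P1 : Matrix V2 V1 ℂ) (hP1 : P1 = fun v u => ((∑ e, ‖a u v e‖ ^ 2 : ℝ) : ℂ))
    (P2 : Matrix V1 V2 ℂ) (hP2 : P2 = fun u v => ((∑ e, ‖b u v e‖ ^ 2 : ℝ) : ℂ))
    (D2 : Matrix V1 V2 ℂ)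
    (hD2 : D2 = fun u v => ∑ e, (starRingEnd ℂ) (a u v e) * b u v e)
    (D1 : Matrix V2 V1 ℂ)
    (hD1 : D1 = fun v u => ∑ e, (starRingEnd ℂ) (b u v e) * a u v e) :
    ∀ u w : V1,
      (D2 * D1) u w = ((starRingEnd ℂ) (π1 w) / (starRingEnd ℂ) (π1 u)) * (P2 * P1) u w := by
  intro u w
  rw [Matrix.mul_apply, Matrix.mul_apply, Finset.mul_sum]
  refine Finset.sum_congr rfl fun v _ => ?_
  have hu : (starRingEnd ℂ) (π1 u) ≠ 0 := (map_ne_zero _).2 (hπ1 u)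
  have hv : (starRingEnd ℂ) (π2 v) ≠ 0 := (map_ne_zero _).2 (hπ2 v)
  simp only [hP1, hP2, hD2, hD1]
  rw [sum_conj_mul_eq_div_mul_sum_norm_sq (hπ1 u) (hQDB u v),
    sum_conj_mul_eq_div_mul_sum_norm_sq (hπ2 v) fun e => (hQDB w v e).symm]
  field_simp
end

section
/- Let V1, V2 and E be finite types, let a, b : V1 → V2 → E → ℂ and π1 : V1 → ℂ, π2 : V2 → ℂ satisfy the quantum detailed balance condition a u v e * π1 u = b u v e * π2 v for all u, v, e, and assume the normalizations Σ_{v,e} |a u v e|² = 1 for every u ∈ V1 and Σ_{u,e} |b u v e|² = 1 for every v ∈ V2. Define (D2)_{uv} := Σ_e conj(a u v e) * (b u v e) and (D1)_{vu} := Σ_e conj(b u v e) * (a u v e). Then D2 · π2 = π1 and D1 · π1 = π2. Consequently, the block matrix D on V1 ⊕ V2 with blocks D(u, v) = (D2)_{uv}, D(v, u) = (D1)_{vu} and zero blocks on V1 × V1 and V2 × V2 satisfies D · (π1 ⊕ π2) = π1 ⊕ π2 and D · (π1 ⊕ (−π2)) = −(π1 ⊕ (−π2)). -/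
/-- If the amplitudes `a` are normalized at every vertex and satisfy `a * π1 = b * π2`, then the
matrix with entries `Σ_e conj (a u v e) * b u v e` maps `π2` to `π1`. -/
theorem discriminant_mulVec_of_detailed_balance {V W E : Type*} [Fintype V] [Fintype W] [Fintype E]
    (a b : V → W → E → ℂ) (π1 : V → ℂ) (π2 : W → ℂ)
    (hQDB : ∀ u v e, a u v e * π1 u = b u v e * π2 v)
    (hanorm : ∀ u, ∑ v, ∑ e, ‖a u v e‖ ^ 2 = 1) :
    Matrix.mulVec (fun u v => ∑ e, (starRingEnd ℂ) (a u v e) * b u v e) π2 = π1 := by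
  funext u
  have h : ∑ v, ∑ e, (‖a u v e‖ : ℂ) ^ 2 = 1 := by exact_mod_cast hanorm u
  calc ∑ v, (∑ e, (starRingEnd ℂ) (a u v e) * b u v e) * π2 v
      = (∑ v, ∑ e, (‖a u v e‖ : ℂ) ^ 2) * π1 u := by
        simp only [Finset.sum_mul, mul_assoc, ← hQDB, ← Complex.conj_mul']
    _ = π1 u := by rw [h, one_mul]

/-- Under the quantum detailed balance condition and the normalizations
`Σ_{v,e} |a u v e|² = 1` and `Σ_{u,e} |b u v e|² = 1`, the discriminant matrices satisfy
`D2 · π2 = π1` and `D1 · π1 = π2`; consequently the block matrix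
`D = fromBlocks 0 D2 D1 0` on `V1 ⊕ V2` has `π1 ⊕ π2` as a `+1`-eigenvector and
`π1 ⊕ (−π2)` as a `−1`-eigenvector. -/
theorem stmt_10 {V1 V2 E : Type*} [Fintype V1] [Fintype V2] [Fintype E]
    (a b : V1 → V2 → E → ℂ) (π1 : V1 → ℂ) (π2 : V2 → ℂ)
    (hQDB : ∀ u v e, a u v e * π1 u = b u v e * π2 v)
    (hanorm : ∀ u, ∑ v, ∑ e, ‖a u v e‖ ^ 2 = 1)
    (hbnorm : ∀ v, ∑ u, ∑ e, ‖b u v e‖ ^ 2 = 1)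
    (D2 : Matrix V1 V2 ℂ)
    (hD2 : D2 = fun u v => ∑ e, (starRingEnd ℂ) (a u v e) * b u v e)
    (D1 : Matrix V2 V1 ℂ)
    (hD1 : D1 = fun v u => ∑ e, (starRingEnd ℂ) (b u v e) * a u v e) :
    D2.mulVec π2 = π1 ∧ D1.mulVec π1 = π2 ∧
    (Matrix.fromBlocks 0 D2 D1 0).mulVec (Sum.elim π1 π2) = Sum.elim π1 π2 ∧
    (Matrix.fromBlocks 0 D2 D1 0).mulVec (Sum.elim π1 (-π2)) =
      -(Sum.elim π1 (-π2)) := by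
  have h2 : D2.mulVec π2 = π1 :=
    hD2 ▸ discriminant_mulVec_of_detailed_balance a b π1 π2 hQDB hanorm
  have h1 : D1.mulVec π1 = π2 :=
    hD1 ▸ discriminant_mulVec_of_detailed_balance (fun v u e => b u v e) (fun v u e => a u v e)
      π2 π1 (fun v u e => (hQDB u v e).symm) hbnorm
  refine ⟨h2, h1, ?_, ?_⟩
  · simp [Matrix.fromBlocks_mulVec, h1, h2]
  · ext (u | v) <;> simp [Matrix.fromBlocks_mulVec, Matrix.mulVec_neg, h1, h2]
end

section
/- Let H be a complex inner product space, V1 and V2 finite types, and let α : V1 → H, β : V2 → H, e : V1 → H be orthonormal families with ⟪e u, α w⟫ = 0 and ⟪e u, β v⟫ = 0 for all u, w ∈ V1 and v ∈ V2. Define α⁺_u := (α u + e u)/√2, α⁻_u := (α u − e u)/√2, the projection Π_β : H → H by Π_β x = Σ_{v∈V2} ⟪β v, x⟫ • β v, and the discriminant matrix 𝒟 indexed by V1 × V1 with 𝒟_{uw} = Σ_{v∈V2} ⟪α u, β v⟫ * ⟪β v, α w⟫. Then for all u, w ∈ V1, ⟪α⁺_u, (2 Π_β − id) (α⁻_w)⟫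 = 𝒟_{uw}; equivalently, ⟪α⁺_u, Π_β (α⁻_w)⟫ = 𝒟_{uw} / 2. -/
open scoped InnerProductSpace

/-- With orthonormal families `α : V1 → H`, `β : V2 → H` and `e : V1 → H`,
where each `e u` is orthogonal to every `α w` and every `β v`, the adapted states
`α⁺_u = (α u + e u)/√2`, `α⁻_w = (α w − e w)/√2` satisfy
`⟪α⁺_u, (2 Π_β − id)(α⁻_w)⟫ = 𝒟_{uw}` and equivalently `⟪α⁺_u, Π_β(α⁻_w)⟫ = 𝒟_{uw}/2`,
where `Π_β x = Σ_v ⟪β v, x⟫ • β v` and `𝒟_{uw} = Σ_v ⟪α u, β v⟫ ⟪β v, α w⟫`. -/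
theorem stmt_12 {H : Type*} [NormedAddCommGroup H] [InnerProductSpace ℂ H]
    {V1 V2 : Type*} [Fintype V1] [Fintype V2]
    (α : V1 → H) (β : V2 → H) (e : V1 → H)
    (hα : Orthonormal ℂ α) (hβ : Orthonormal ℂ β) (he : Orthonormal ℂ e)
    (heα : ∀ u w, ⟪e u, α w⟫_ℂ = 0) (heβ : ∀ u v, ⟪e u, β v⟫_ℂ = 0)
    (Pβ : H → H) (hPβ : Pβ = fun x => ∑ v, ⟪β v, x⟫_ℂ • β v)
    (𝒟 : Matrix V1 V1 ℂ)
    (h𝒟 : 𝒟 = fun u w => ∑ v, ⟪α u, β v⟫_ℂ * ⟪β v, α w⟫_ℂ)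
    (αp αm : V1 → H)
    (hαp : αp = fun u => (((Real.sqrt 2 : ℝ) : ℂ)⁻¹) • (α u + e u))
    (hαm : αm = fun u => (((Real.sqrt 2 : ℝ) : ℂ)⁻¹) • (α u - e u)) :
    ∀ u w : V1,
      ⟪αp u, (2 : ℂ) • Pβ (αm w) - αm w⟫_ℂ = 𝒟 u w ∧
      ⟪αp u, Pβ (αm w)⟫_ℂ = 𝒟 u w / 2 := by
  classical
  subst hPβ h𝒟 hαp hαm
  intro u w
  have hαe : ∀ u w, ⟪α u, e w⟫_ℂ = 0 := fun u w => inner_eq_zero_symm.mp (heα w u)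
  have hβe : ∀ v w, ⟪β v, e w⟫_ℂ = 0 := fun v w => inner_eq_zero_symm.mp (heβ w v)
  have hsq : (((Real.sqrt 2 : ℝ) : ℂ)⁻¹) * (((Real.sqrt 2 : ℝ) : ℂ)⁻¹) = 1 / 2 := by
    rw [← mul_inv, ← Complex.ofReal_mul, Real.mul_self_sqrt (by norm_num)]
    norm_num
  have hproj : ⟪(((Real.sqrt 2 : ℝ) : ℂ)⁻¹) • (α u + e u),
      ∑ v, ⟪β v, (((Real.sqrt 2 : ℝ) : ℂ)⁻¹) • (α w - e w)⟫_ℂ • β v⟫_ℂ =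
      (∑ v, ⟪α u, β v⟫_ℂ * ⟪β v, α w⟫_ℂ) / 2 := by
    rw [inner_sum, Finset.sum_div]
    refine Finset.sum_congr rfl fun v _ => ?_
    simp only [inner_smul_left, inner_smul_right, inner_add_left, inner_sub_right, heβ, hβe,
      map_inv₀, Complex.conj_ofReal, add_zero, sub_zero]
    linear_combination (⟪α u, β v⟫_ℂ * ⟪β v, α w⟫_ℂ) * hsq
  have horth : ⟪(((Real.sqrt 2 : ℝ) : ℂ)⁻¹) • (α u + e u),
      (((Real.sqrt 2 : ℝ) : ℂ)⁻¹) • (α w - e w)⟫_ℂ = 0 := by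
    simp only [inner_smul_left, inner_smul_right, inner_add_left, inner_sub_right, heα, hαe,
      orthonormal_iff_ite.mp hα, orthonormal_iff_ite.mp he]
    ring
  refine ⟨?_, hproj⟩
  rw [inner_sub_right, inner_smul_right, horth, hproj]
  ring
end

section
/- Let H be a complex inner product space, V1 and V2 finite types, and let α : V1 → H, β : V2 → H, e : V1 → H, f : V1 → H be orthonormal families such that each e u and each f u is orthogonal to every α w and every β v, and each f u is orthogonal to every e w. Define α⁺_u := (α u + e u)/√2, α⁻_u := (α u − e u)/√2, the projection Π_β x = Σ_{v∈V2} ⟪β v, x⟫ • β v, the reflection R := 2 Π_β − id, and the discriminant 𝒟_{uw} = Σ_{v∈V2} ⟪α u, β v⟫ * ⟪β v, α w⟫. Let M ⊆ V1 be a set of marked vertices and let r ∈ [0, 1]. Define ψ_u := α⁺_u if u ∉ M and ψ_u := √(1−r) • α⁺_u + √r • f_u if u ∈ M, and φ_w := α⁻_w if w ∉ M and φ_w := √(1−r) • α⁻_w − √r • f_w if w ∈ M. Then for all u, w ∈ V1: ⟪ψ_u, R φ_w⟫ = 𝒟_{uw} if u ∉ M and w ∉ M; ⟪ψ_u, R φ_w⟫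 = √(1−r) · 𝒟_{uw} if exactly one of u, w lies in M; and ⟪ψ_u, R φ_w⟫ = (1−r) · 𝒟_{uw} + r · δ_{uw} if u ∈ M and w ∈ M. In other words, the interpolated adapted walk implements the interpolated discriminant matrix 𝒟(r) whose blocks are 𝒟_{\bar M \bar M}, √(1−r) 𝒟_{\bar M M}, √(1−r) 𝒟_{M \bar M}, and (1−r) 𝒟_{M M} + r I. -/
open scoped InnerProductSpace

section Reflection

variable {H : Type*} [NormedAddCommGroup H] [InnerProductSpace ℂ H]

/-- The matrix element of the reflection `2 Π_β - id` between two vectors. -/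
lemma inner_two_smul_sum_sub {V : Type*} [Fintype V] (β : V → H) (x y : H) :
    ⟪x, (2 : ℂ) • (∑ v, ⟪β v, y⟫_ℂ • β v) - y⟫_ℂ =
      2 * ∑ v, ⟪x, β v⟫_ℂ * ⟪β v, y⟫_ℂ - ⟪x, y⟫_ℂ := by
  simp only [inner_sub_right, inner_smul_right, inner_sum, mul_comm]

/-- The reflection `2 Π_β - id` negates vectors orthogonal to every `β v`. -/
lemma two_smul_sum_sub_eq_neg {V : Type*} [Fintype V] (β : V → H) {y : H}
    (hy : ∀ v, ⟪β v, y⟫_ℂ = 0) :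
    (2 : ℂ) • (∑ v, ⟪β v, y⟫_ℂ • β v) - y = -y := by
  simp [hy]

lemma two_smul_sum_sub_smul_sub_smul {V : Type*} [Fintype V] (β : V → H) (a b : ℂ) (x y : H) :
    (2 : ℂ) • (∑ v, ⟪β v, a • x - b • y⟫_ℂ • β v) - (a • x - b • y) =
      a • ((2 : ℂ) • (∑ v, ⟪β v, x⟫_ℂ • β v) - x) -
        b • ((2 : ℂ) • (∑ v, ⟪β v, y⟫_ℂ • β v) - y) := by
  simp only [inner_sub_right, inner_smul_right, sub_smul, mul_smul, Finset.sum_sub_distrib,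
    ← Finset.smul_sum]
  module

end Reflection

/-- With orthonormal families `α : V1 → H`, `β : V2 → H`, `e f : V1 → H`
satisfying the stated mutual orthogonality relations, marked set `M ⊆ V1` and interpolation
parameter `r ∈ [0,1]`, the interpolated adapted states
`ψ_u = α⁺_u` (`u ∉ M`), `ψ_u = √(1−r) • α⁺_u + √r • f u` (`u ∈ M`),
`φ_w = α⁻_w` (`w ∉ M`), `φ_w = √(1−r) • α⁻_w − √r • f w` (`w ∈ M`)
satisfy `⟪ψ_u, R φ_w⟫ = 𝒟_{uw}`, `√(1−r) 𝒟_{uw}`, or `(1−r) 𝒟_{uw} + r δ_{uw}` according to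
whether none, exactly one, or both of `u, w` are marked, where `R = 2 Π_β − id` and
`𝒟_{uw} = Σ_v ⟪α u, β v⟫ ⟪β v, α w⟫`: the interpolated adapted walk implements the
interpolated discriminant `𝒟(r)`. -/
theorem stmt_14 {H : Type*} [NormedAddCommGroup H] [InnerProductSpace ℂ H]
    {V1 V2 : Type*} [Fintype V1] [Fintype V2] [DecidableEq V1]
    (α : V1 → H) (β : V2 → H) (e f : V1 → H)
    (hα : Orthonormal ℂ α) (hβ : Orthonormal ℂ β)
    (he : Orthonormal ℂ e) (hf : Orthonormal ℂ f)
    (heα : ∀ u w, ⟪e u, α w⟫_ℂ = 0) (heβ : ∀ u v, ⟪e u, β v⟫_ℂ = 0)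
    (hfα : ∀ u w, ⟪f u, α w⟫_ℂ = 0) (hfβ : ∀ u v, ⟪f u, β v⟫_ℂ = 0)
    (hfe : ∀ u w, ⟪f u, e w⟫_ℂ = 0)
    (M : Set V1) [DecidablePred (· ∈ M)]
    (r : ℝ) (hr0 : 0 ≤ r) (hr1 : r ≤ 1)
    (αp αm : V1 → H)
    (hαp : αp = fun u => (((Real.sqrt 2 : ℝ) : ℂ)⁻¹) • (α u + e u))
    (hαm : αm = fun u => (((Real.sqrt 2 : ℝ) : ℂ)⁻¹) • (α u - e u))
    (R : H → H) (hR : R = fun x => (2 : ℂ) • (∑ v, ⟪β v, x⟫_ℂ • β v) - x)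
    (𝒟 : Matrix V1 V1 ℂ)
    (h𝒟 : 𝒟 = fun u w => ∑ v, ⟪α u, β v⟫_ℂ * ⟪β v, α w⟫_ℂ)
    (ψ φ : V1 → H)
    (hψ : ψ = fun u => if u ∈ M then
        ((Real.sqrt (1 - r) : ℝ) : ℂ) • αp u + ((Real.sqrt r : ℝ) : ℂ) • f u
      else αp u)
    (hφ : φ = fun w => if w ∈ M then
        ((Real.sqrt (1 - r) : ℝ) : ℂ) • αm w - ((Real.sqrt r : ℝ) : ℂ) • f w
      else αm w) :
    ∀ u w : V1,
      (u ∉ M → w ∉ M → ⟪ψ u, R (φ w)⟫_ℂ = 𝒟 u w) ∧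
      ((u ∈ M ∧ w ∉ M) ∨ (u ∉ M ∧ w ∈ M) →
        ⟪ψ u, R (φ w)⟫_ℂ = ((Real.sqrt (1 - r) : ℝ) : ℂ) * 𝒟 u w) ∧
      (u ∈ M → w ∈ M →
        ⟪ψ u, R (φ w)⟫_ℂ =
          ((1 - r : ℝ) : ℂ) * 𝒟 u w + ((r : ℝ) : ℂ) * (if u = w then 1 else 0)) := by
  have hβe : ∀ v u, ⟪β v, e u⟫_ℂ = 0 := fun v u => inner_eq_zero_symm.mp (heβ u v)
  have hβf : ∀ v u, ⟪β v, f u⟫_ℂ = 0 := fun v u => inner_eq_zero_symm.mp (hfβ u v)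
  have hαe : ∀ w u, ⟪α w, e u⟫_ℂ = 0 := fun w u => inner_eq_zero_symm.mp (heα u w)
  have hαf : ∀ w u, ⟪α w, f u⟫_ℂ = 0 := fun w u => inner_eq_zero_symm.mp (hfα u w)
  have hef : ∀ w u, ⟪e w, f u⟫_ℂ = 0 := fun w u => inner_eq_zero_symm.mp (hfe u w)
  have sqrt_two_inv_sq : (((Real.sqrt 2 : ℝ) : ℂ)⁻¹) * ((Real.sqrt 2 : ℝ) : ℂ)⁻¹ = 2⁻¹ := by
    rw [← mul_inv, ← Complex.ofReal_mul, Real.mul_self_sqrt zero_le_two, Complex.ofReal_ofNat]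
  have sqrt_sq : ((Real.sqrt r : ℝ) : ℂ) * ((Real.sqrt r : ℝ) : ℂ) = (r : ℂ) := by
    rw [← Complex.ofReal_mul, Real.mul_self_sqrt hr0]
  have sqrt_one_sub_sq :
      ((Real.sqrt (1 - r) : ℝ) : ℂ) * ((Real.sqrt (1 - r) : ℝ) : ℂ) = ((1 - r : ℝ) : ℂ) := by
    rw [← Complex.ofReal_mul, Real.mul_self_sqrt (sub_nonneg.mpr hr1)]
  have inner_αp_αm : ∀ u w, ⟪αp u, αm w⟫_ℂ = 0 := fun u w => by
    simp [hαp, hαm, hαe, heα, orthonormal_iff_ite.mp hα, orthonormal_iff_ite.mp he]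
  have inner_αp_R_αm : ∀ u w, ⟪αp u, R (αm w)⟫_ℂ = 𝒟 u w := fun u w => by
    have h : ∀ v, ⟪αp u, β v⟫_ℂ * ⟪β v, αm w⟫_ℂ =
        2⁻¹ * (⟪α u, β v⟫_ℂ * ⟪β v, α w⟫_ℂ) := fun v => by
      simp only [hαp, hαm, inner_add_left, inner_sub_right, inner_smul_left, inner_smul_right,
        heβ, hβe, map_inv₀, Complex.conj_ofReal, ← sqrt_two_inv_sq]
      ring
    simp only [hR, inner_two_smul_sum_sub, inner_αp_αm, h, ← Finset.mul_sum, h𝒟]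
    ring
  have R_f : ∀ w, R (f w) = -f w := fun w => by
    rw [hR]
    exact two_smul_sum_sub_eq_neg β fun v => hβf v w
  have inner_αp_R_f : ∀ u w, ⟪αp u, R (f w)⟫_ℂ = 0 := fun u w => by
    simp [R_f, hαp, inner_add_left, inner_smul_left, hαf, hef]
  have inner_f_R_αm : ∀ u w, ⟪f u, R (αm w)⟫_ℂ = 0 := fun u w => by
    simp [hR, hαm, hfα, hfe, hfβ]
  have inner_f_R_f : ∀ u w, ⟪f u, R (f w)⟫_ℂ = -(if u = w then 1 else 0) := fun u w => by
    rw [R_f, inner_neg_right, orthonormal_iff_ite.mp hf]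
  have R_sub : ∀ (a b : ℂ) (x y : H), R (a • x - b • y) = a • R x - b • R y := fun a b x y => by
    simp only [hR, two_smul_sum_sub_smul_sub_smul]
  intro u w
  refine ⟨fun hu hw => ?_, ?_, fun hu hw => ?_⟩
  · simp only [hψ, hφ, hu, hw, if_false, inner_αp_R_αm]
  · rintro (⟨hu, hw⟩ | ⟨hu, hw⟩)
    · simp only [hψ, hφ, hu, hw, if_true, if_false, inner_add_left, inner_smul_left,
        Complex.conj_ofReal, inner_αp_R_αm, inner_f_R_αm, mul_zero, add_zero]
    · simp only [hψ, hφ, hu, hw, if_true, if_false, R_sub, inner_sub_right, inner_smul_right,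
        inner_αp_R_αm, inner_αp_R_f, mul_zero, sub_zero]
  · simp only [hψ, hφ, hu, hw, if_true, R_sub, inner_add_left, inner_sub_right, inner_smul_left,
      inner_smul_right, Complex.conj_ofReal, inner_αp_R_αm, inner_αp_R_f, inner_f_R_αm,
      inner_f_R_f, ← sqrt_sq, ← sqrt_one_sub_sq]
    ring
end
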